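/- arXiv:1001.1093 — 3 statements merged into one kernel-verified Lean document; each statement's English description precedes it below -/
import Mathlib

section
/- (Transmitters of a Cart8 site occupy at least four IPEs) Let t : Fin 8 → D be an assignment of frequencies to eight transmission paths such that |t(i) − t(j)| ≥ 100 for all i ≠ j. Then the number of IPEs that contain at least one of the frequencies t(0), …, t(7) is at least 4. -/
/-- The first small IPE. -/
def IPE0 : Finset ℕ := {40000, 40070, 40140}
/-- The second small IPE. -/
def IPE1 : Finset ℕ := {41000, 41070, 41140}
/-- The third small IPE. -/
def IPE2 : Finset ℕ := {42000, 42070, 42140}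
/-- The fourth small IPE. -/
def IPE3 : Finset ℕ := {43000, 43070, 43140}
/-- The first large IPE. -/
def IPE4 : Finset ℕ := {44000, 44070, 44140, 44210}
/-- The second large IPE. -/
def IPE5 : Finset ℕ := {45000, 45070, 45140, 45210}

/-- The list of the four small IPEs. -/
def smallIPEs : List (Finset ℕ) := [IPE0, IPE1, IPE2, IPE3]
/-- The list of the two large IPEs. -/
def largeIPEs : List (Finset ℕ) := [IPE4, IPE5]
/-- The list of all six IPEs. -/
def allIPEs : List (Finset ℕ) := [IPE0, IPE1, IPE2, IPE3, IPE4, IPE5]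
/-- The six IPEs as a finite set of finite sets. -/
def IPEs : Finset (Finset ℕ) := {IPE0, IPE1, IPE2, IPE3, IPE4, IPE5}
/-- The frequency domain: the union of the six IPEs. -/
def Dom : Finset ℕ := IPE0 ∪ IPE1 ∪ IPE2 ∪ IPE3 ∪ IPE4 ∪ IPE5

/-- Every IPE splits into two halves, according to the offset from its lowest frequency. -/
theorem IPEs_half_lt_two : ∀ I ∈ IPEs, ∀ x ∈ I, x % 1000 / 140 < 2 := by
  decide

/-- Frequencies in the same half of an IPE are less than 100 apart. -/
theorem IPEs_lt_add_of_half_eq :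
    ∀ I ∈ IPEs, ∀ x ∈ I, ∀ y ∈ I, x % 1000 / 140 = y % 1000 / 140 → x < y + 100 := by
  decide

theorem exists_mem_IPEs_of_mem_Dom {x : ℕ} (hx : x ∈ Dom) : ∃ I ∈ IPEs, x ∈ I := by
  revert x
  decide

/-- An IPE contains at most two of a family of frequencies pairwise at least 100 apart. -/
theorem card_filter_mem_IPE_le_two {ι : Type*} [Fintype ι] (t : ι → ℕ)
    (hsep : ∀ i j, i ≠ j → |(t i : ℤ) - (t j : ℤ)| ≥ 100) {I : Finset ℕ} (hI : I ∈ IPEs) :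
    (Finset.univ.filter (fun i => t i ∈ I)).card ≤ 2 := by
  rw [← Finset.card_range 2]
  refine Finset.card_le_card_of_injOn (fun i => t i % 1000 / 140) (fun i hi => ?_)
    (fun i hi j hj hij => ?_)
  · simp only [Finset.coe_filter, Set.mem_ofPred_eq] at hi
    exact Finset.mem_coe.2 (Finset.mem_range.2 (IPEs_half_lt_two I hI _ hi.2))
  · simp only [Finset.coe_filter, Set.mem_ofPred_eq] at hi hj
    by_contra hne
    have hgap := hsep i j hne
    have hlt := IPEs_lt_add_of_half_eq I hI _ hi.2 _ hj.2 hij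
    have hgt := IPEs_lt_add_of_half_eq I hI _ hj.2 _ hi.2 hij.symm
    exact absurd (abs_lt.2 ⟨by omega, by omega⟩) (not_lt.2 hgap)

/-- the eight transmission frequencies of a Cart8 site, pairwise
separated by at least 100, occupy at least four of the six IPEs. -/
theorem cart8_transmitters_need_four_IPEs
    (t : Fin 8 → ℕ)
    (ht : ∀ i, t i ∈ Dom)
    (hsep : ∀ i j, i ≠ j → |(t i : ℤ) - (t j : ℤ)| ≥ 100) :
    4 ≤ (IPEs.filter (fun I => ∃ i, t i ∈ I)).card := by
  have hcover : Finset.univ ⊆ (IPEs.filter (fun I => ∃ i, t i ∈ I)).biUnion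
      (fun I => Finset.univ.filter (fun i => t i ∈ I)) := fun i _ => by
    obtain ⟨I, hI, hiI⟩ := exists_mem_IPEs_of_mem_Dom (ht i)
    exact Finset.mem_biUnion.2
      ⟨I, Finset.mem_filter.2 ⟨hI, i, hiI⟩, Finset.mem_filter.2 ⟨Finset.mem_univ i, hiI⟩⟩
  have hcard := (Finset.card_le_card hcover).trans
    (Finset.card_biUnion_le_card_mul _ _ 2 fun I hI =>
      card_filter_mem_IPE_le_two t hsep (Finset.mem_filter.1 hI).1)
  rw [Finset.card_univ, Fintype.card_fin] at hcard
  omega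
end

section
/- (Cart8 domain reduction theorem) Let t : Fin 8 → D and r : Fin 8 → D be assignments of frequencies to the eight transmission paths and eight reception paths of a Cart8 site such that: (i) |t(i) − t(j)| ≥ 100 for all i ≠ j (transmitter-transmitter constraints); (ii) r is injective (distinct reception frequencies); and (iii) |t(i) − r(j)| ≥ 220 for all i, j (transmitter-receiver constraints). Then the set of reception frequencies is exactly {44000, 44070, 44140, 44210, 45000, 45070, 45140, 45210} (the union of the two large IPEs) and the set of transmission frequencies is exactly {40000, 40140, 41000, 41140, 42000, 42140, 43000, 43140} (the two extreme frequencies of each of the four small IPEs). -/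
/-- Index of the half of an IPE containing a frequency: offsets `0, 70` form the lower half of an
IPE, offsets `140, 210` the upper half. -/
def halfIndex (f : ℕ) : ℕ := 2 * (f / 1000) + f % 1000 / 140

theorem sub_lt_of_halfIndex_eq : ∀ f ∈ Dom, ∀ g ∈ Dom, halfIndex f = halfIndex g →
    |(f : ℤ) - (g : ℤ)| < 100 := by
  decide +kernel

theorem sub_lt_of_div_eq : ∀ f ∈ Dom, ∀ g ∈ Dom, f / 1000 = g / 1000 →
    |(f : ℤ) - (g : ℤ)| < 220 := by
  decide +kernel

theorem div_mem_of_mem_Dom : ∀ f ∈ Dom, f / 1000 ∈ Finset.Icc 40 45 := by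
  decide +kernel

/-- The only way to set aside four or more IPEs while leaving eight frequencies is to set aside
exactly the four small ones. -/
theorem eq_small_of_card : ∀ A ∈ (Finset.Icc 40 45).powerset, 4 ≤ A.card →
    8 ≤ (Dom.filter fun f => f / 1000 ∉ A).card → A = Finset.Icc 40 43 := by
  decide +kernel

theorem halfIndex_mem_of_small : ∀ f ∈ Dom, f / 1000 ∈ Finset.Icc 40 43 →
    halfIndex f ∈ Finset.Icc 80 87 := by
  decide +kernel

/-- A frequency of a small IPE that is not extreme lies in a lower half, and is too close to every
frequency of the matching upper half. -/
theorem extreme_or_close : ∀ f ∈ Dom, f / 1000 ∈ Finset.Icc 40 43 →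
    f ∈ ({40000, 40140, 41000, 41140, 42000, 42140, 43000, 43140} : Finset ℕ) ∨
      halfIndex f + 1 ∈ Finset.Icc 80 87 ∧
        ∀ g ∈ Dom, halfIndex g = halfIndex f + 1 → g / 1000 ∈ Finset.Icc 40 43 →
          |(f : ℤ) - (g : ℤ)| < 100 := by
  decide +kernel

/-- Cart8 domain reduction theorem: under the
transmitter-transmitter constraints (gap 100), injectivity of the reception
assignment, and the transmitter-receiver constraints (gap 220), the reception
frequencies are exactly the union of the two large IPEs and the transmission
frequencies are exactly the two extreme frequencies of each small IPE. -/
theorem cart8_domain_reduction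
    (t r : Fin 8 → ℕ)
    (ht : ∀ i, t i ∈ Dom) (hr : ∀ j, r j ∈ Dom)
    (htt : ∀ i j, i ≠ j → |(t i : ℤ) - (t j : ℤ)| ≥ 100)
    (hrinj : Function.Injective r)
    (htr : ∀ i j, |(t i : ℤ) - (r j : ℤ)| ≥ 220) :
    Finset.image r Finset.univ =
      ({44000, 44070, 44140, 44210, 45000, 45070, 45140, 45210} : Finset ℕ) ∧
    Finset.image t Finset.univ =
      ({40000, 40140, 41000, 41140, 42000, 42140, 43000, 43140} : Finset ℕ) := by
  have hcinj : Function.Injective fun i => halfIndex (t i) := by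
    intro i j hij
    by_contra hne
    exact absurd (htt i j hne) (not_le.2 (sub_lt_of_halfIndex_eq _ (ht i) _ (ht j) hij))
  have htinj : Function.Injective t := fun i j hij => hcinj (congrArg halfIndex hij)
  have hTcard : (Finset.univ.image t).card = 8 := by
    rw [Finset.card_image_of_injective _ htinj]; rfl
  have hRcard : (Finset.univ.image r).card = 8 := by
    rw [Finset.card_image_of_injective _ hrinj]; rfl
  have hCcard : (Finset.univ.image fun i => halfIndex (t i)).card = 8 := by
    rw [Finset.card_image_of_injective _ hcinj]; rfl
  set A := Finset.univ.image fun i => t i / 1000 with hA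
  have hAcard : 4 ≤ A.card := by
    have hsub : (Finset.univ.image fun i => (t i / 1000, t i % 1000 / 140)) ⊆
        A ×ˢ Finset.range 2 := by
      intro p hp
      obtain ⟨i, -, rfl⟩ := Finset.mem_image.1 hp
      have hoff : ∀ f ∈ Dom, f % 1000 / 140 < 2 := by decide +kernel
      exact Finset.mem_product.2
        ⟨Finset.mem_image_of_mem _ (Finset.mem_univ i), Finset.mem_range.2 (hoff _ (ht i))⟩
    have hcard := Finset.card_le_card hsub
    rw [Finset.card_image_of_injective, Finset.card_product, Finset.card_range,
      Finset.card_univ, Fintype.card_fin] at hcard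
    · omega
    · intro i j hij
      apply hcinj
      simp only [Prod.mk.injEq] at hij
      simp only [halfIndex, hij.1, hij.2]
  have hRsub : Finset.univ.image r ⊆ Dom.filter fun f => f / 1000 ∉ A := by
    intro f hf
    obtain ⟨j, -, rfl⟩ := Finset.mem_image.1 hf
    refine Finset.mem_filter.2 ⟨hr j, fun hmem => ?_⟩
    obtain ⟨i, -, hi⟩ := Finset.mem_image.1 hmem
    exact absurd (htr i j) (not_le.2 (sub_lt_of_div_eq _ (ht i) _ (hr j) hi))
  have hAeq : A = Finset.Icc 40 43 := by
    refine eq_small_of_card A (Finset.mem_powerset.2 ?_) hAcard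
      (hRcard ▸ Finset.card_le_card hRsub)
    intro b hb
    obtain ⟨i, -, rfl⟩ := Finset.mem_image.1 hb
    exact div_mem_of_mem_Dom _ (ht i)
  have hsmall : ∀ i, t i / 1000 ∈ Finset.Icc 40 43 := fun i =>
    hAeq ▸ Finset.mem_image_of_mem (fun i => t i / 1000) (Finset.mem_univ i)
  have hC : (Finset.univ.image fun i => halfIndex (t i)) = Finset.Icc 80 87 := by
    apply Finset.eq_of_subset_of_card_le
    · intro c hc
      obtain ⟨i, -, rfl⟩ := Finset.mem_image.1 hc
      exact halfIndex_mem_of_small _ (ht i) (hsmall i)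
    · rw [hCcard]; decide
  constructor
  · have hfilter : (Dom.filter fun f => f / 1000 ∉ Finset.Icc 40 43) =
        {44000, 44070, 44140, 44210, 45000, 45070, 45140, 45210} := by
      decide +kernel
    rw [hAeq, hfilter] at hRsub
    exact Finset.eq_of_subset_of_card_le hRsub (by rw [hRcard]; decide)
  · refine Finset.eq_of_subset_of_card_le (fun f hf => ?_) (by rw [hTcard]; decide)
    obtain ⟨i, -, rfl⟩ := Finset.mem_image.1 hf
    refine (extreme_or_close _ (ht i) (hsmall i)).resolve_right fun ⟨hmem, hclose⟩ => ?_
    rw [← hC] at hmem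
    obtain ⟨j, -, hj⟩ := Finset.mem_image.1 hmem
    have hne : i ≠ j := by
      rintro rfl
      exact absurd hj (Nat.lt_succ_self _).ne
    exact absurd (htt i j hne) (not_le.2 (hclose _ (ht j) hj (hsmall j)))
end

section
/- (Transmitters of a Cart8 site occupy exactly the four small IPEs, two per IPE) Let t : Fin 8 → D assign frequencies to eight transmission paths with |t(i) − t(j)| ≥ 100 for all i ≠ j, and let r : Fin 8 → D be injective with |t(i) − r(j)| ≥ 220 for all i, j. Then every one of the four small IPEs IPE0, IPE1, IPE2, IPE3 contains exactly two of the transmission frequencies t(0), …, t(7), and neither large IPE contains any transmission frequency. -/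
/-- If `I` is covered by two windows narrower than `d`, it contains at most two points of a set
with gaps at least `d`. -/
theorem card_inter_le_two_of_gap {T I : Finset ℕ} {a b a' b' d : ℕ} (hab : b < a + d)
    (hab' : b' < a' + d) (hI : I ⊆ Finset.Icc a b ∪ Finset.Icc a' b')
    (hT : ∀ x ∈ T, ∀ y ∈ T, x ≠ y → |(x : ℤ) - y| ≥ d) : (T ∩ I).card ≤ 2 := by
  by_contra! h
  obtain ⟨x, y, z, hx, hy, hz, hxy, hxz, hyz⟩ := Finset.two_lt_card_iff.1 h
  rw [Finset.mem_inter] at hx hy hz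
  have hx' := hI hx.2
  have hy' := hI hy.2
  have hz' := hI hz.2
  simp only [Finset.mem_union, Finset.mem_Icc] at hx' hy' hz'
  have h₁ := hT x hx.1 y hy.1 hxy
  have h₂ := hT x hx.1 z hz.1 hxz
  have h₃ := hT y hy.1 z hz.1 hyz
  rw [ge_iff_le, le_abs] at h₁ h₂ h₃
  omega

/-- If every point of `T` is at distance at least `d` from every point of `R`, then a window
narrower than `d` cannot meet both `T` and `R`. -/
theorem card_inter_eq_zero_or_of_gap {T R I : Finset ℕ} {a b d : ℕ} (hab : b < a + d)
    (hI : I ⊆ Finset.Icc a b) (hTR : ∀ x ∈ T, ∀ y ∈ R, |(x : ℤ) - y| ≥ d) :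
    (T ∩ I).card = 0 ∨ (R ∩ I).card = 0 := by
  by_contra! h
  obtain ⟨x, hx⟩ := Finset.card_ne_zero.1 h.1
  obtain ⟨y, hy⟩ := Finset.card_ne_zero.1 h.2
  rw [Finset.mem_inter] at hx hy
  have hx' := Finset.mem_Icc.1 (hI hx.2)
  have hy' := Finset.mem_Icc.1 (hI hy.2)
  have hxy := hTR x hx.1 y hy.1
  rw [ge_iff_le, le_abs] at hxy
  omega

theorem card_le_sum_card_inter_IPEs {T : Finset ℕ} (hT : T ⊆ Dom) :
    T.card ≤ (T ∩ IPE0).card + (T ∩ IPE1).card + (T ∩ IPE2).card + (T ∩ IPE3).card +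
      (T ∩ IPE4).card + (T ∩ IPE5).card := by
  conv_lhs => rw [← Finset.inter_eq_left.2 hT, Dom]
  simp only [Finset.inter_union_distrib_left]
  iterate 4 refine (Finset.card_union_le _ _).trans (Nat.add_le_add_right ?_ _)
  exact Finset.card_union_le _ _

/-- under the Cart8 constraints, every small IPE contains exactly
two of the eight transmission frequencies, and neither large IPE contains any
transmission frequency. -/
theorem cart8_transmitters_two_per_small_IPE
    (t r : Fin 8 → ℕ)
    (ht : ∀ i, t i ∈ Dom) (hr : ∀ j, r j ∈ Dom)
    (htt : ∀ i j, i ≠ j → |(t i : ℤ) - (t j : ℤ)| ≥ 100)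
    (hrinj : Function.Injective r)
    (htr : ∀ i j, |(t i : ℤ) - (r j : ℤ)| ≥ 220) :
    (∀ I ∈ smallIPEs, (Finset.image t Finset.univ ∩ I).card = 2) ∧
    (∀ I ∈ largeIPEs, ∀ i, t i ∉ I) := by
  have htinj : Function.Injective t := fun i j hij => by
    by_contra hne
    simpa [hij] using htt i j hne
  set T := Finset.image t Finset.univ with hTdef
  set R := Finset.image r Finset.univ with hRdef
  have hT : 8 ≤ _ := (Finset.card_image_of_injective Finset.univ htinj).symm.trans_le
    (card_le_sum_card_inter_IPEs (T := T) (Finset.image_subset_iff.2 fun i _ => ht i))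
  have hR : 8 ≤ _ := (Finset.card_image_of_injective Finset.univ hrinj).symm.trans_le
    (card_le_sum_card_inter_IPEs (T := R) (Finset.image_subset_iff.2 fun i _ => hr i))
  have hTT : ∀ x ∈ T, ∀ y ∈ T, x ≠ y → |(x : ℤ) - y| ≥ (100 : ℕ) := by
    simp only [hTdef, Finset.mem_image, Finset.mem_univ, true_and]
    rintro _ ⟨i, rfl⟩ _ ⟨j, rfl⟩ hij
    exact htt i j fun h => hij (congrArg t h)
  have hTR : ∀ x ∈ T, ∀ y ∈ R, |(x : ℤ) - y| ≥ (220 : ℕ) := by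
    simp only [hTdef, hRdef, Finset.mem_image, Finset.mem_univ, true_and]
    rintro _ ⟨i, rfl⟩ _ ⟨j, rfl⟩
    exact htr i j
  have two {I : Finset ℕ} (a : ℕ)
      (hI : I ⊆ Finset.Icc a (a + 70) ∪ Finset.Icc (a + 140) (a + 210)) : (T ∩ I).card ≤ 2 :=
    card_inter_le_two_of_gap (by omega) (by omega) hI hTT
  have excl {I : Finset ℕ} (a : ℕ) (hI : I ⊆ Finset.Icc a (a + 210)) :
      (T ∩ I).card = 0 ∨ (R ∩ I).card = 0 :=
    card_inter_eq_zero_or_of_gap (by omega) hI hTR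
  have t0 := two (I := IPE0) 40000 (by simp [IPE0, Finset.insert_subset_iff])
  have e0 := excl (I := IPE0) 40000 (by simp [IPE0, Finset.insert_subset_iff])
  have r0 : (R ∩ IPE0).card ≤ 3 := Finset.card_le_card Finset.inter_subset_right
  have t1 := two (I := IPE1) 41000 (by simp [IPE1, Finset.insert_subset_iff])
  have e1 := excl (I := IPE1) 41000 (by simp [IPE1, Finset.insert_subset_iff])
  have r1 : (R ∩ IPE1).card ≤ 3 := Finset.card_le_card Finset.inter_subset_right
  have t2 := two (I := IPE2) 42000 (by simp [IPE2, Finset.insert_subset_iff])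
  have e2 := excl (I := IPE2) 42000 (by simp [IPE2, Finset.insert_subset_iff])
  have r2 : (R ∩ IPE2).card ≤ 3 := Finset.card_le_card Finset.inter_subset_right
  have t3 := two (I := IPE3) 43000 (by simp [IPE3, Finset.insert_subset_iff])
  have e3 := excl (I := IPE3) 43000 (by simp [IPE3, Finset.insert_subset_iff])
  have r3 : (R ∩ IPE3).card ≤ 3 := Finset.card_le_card Finset.inter_subset_right
  have t4 := two (I := IPE4) 44000 (by simp [IPE4, Finset.insert_subset_iff])
  have e4 := excl (I := IPE4) 44000 (by simp [IPE4, Finset.insert_subset_iff])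
  have r4 : (R ∩ IPE4).card ≤ 4 := Finset.card_le_card Finset.inter_subset_right
  have t5 := two (I := IPE5) 45000 (by simp [IPE5, Finset.insert_subset_iff])
  have e5 := excl (I := IPE5) 45000 (by simp [IPE5, Finset.insert_subset_iff])
  have r5 : (R ∩ IPE5).card ≤ 4 := Finset.card_le_card Finset.inter_subset_right
  have notMem {I : Finset ℕ} (h : (T ∩ I).card = 0) (i : Fin 8) : t i ∉ I := fun hi =>
    Finset.card_ne_zero.2
      ⟨t i, Finset.mem_inter.2 ⟨Finset.mem_image_of_mem t (Finset.mem_univ i), hi⟩⟩ h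
  simp only [smallIPEs, largeIPEs, List.forall_mem_cons, List.not_mem_nil, false_imp_iff,
    implies_true, and_true]
  exact ⟨⟨by omega, by omega, by omega, by omega⟩, notMem (by omega), notMem (by omega)⟩
end
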